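/- Let κ > 0 and ṽ_2^κ(r) = i · D_2( exp(e^{-i 3π/4} κ r) - exp(e^{i 3π/4} κ r) ), with (D_2 w)(r) = w''(r) - 3w'(r)/r + 3w(r)/r^2. Then as r → 0⁺: ṽ_2^κ(r) → κ^2, (ṽ_2^κ)'(r) → 0, (ṽ_2^κ)''(r) → 0, and (ṽ_2^κ)'''(r) → -(2√2/5) κ^5. In particular the boundary values satisfy (ṽ_2^κ)'''(0) = -(2√2/5) κ^3 ṽ_2^κ(0) together with (ṽ_2^κ)'(0) = (ṽ_2^κ)''(0) = 0, so ṽ_2^κ lies in the domain of the self-adjoint extension T_{2κ}^2. -/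

import Mathlib

open Set Filter Topology

/-- The differential operation `(D_2 w)(r) = w''(r) - 3w'(r)/r + 3w(r)/r²`. -/
noncomputable def D2 (w : ℝ → ℂ) : ℝ → ℂ :=
  fun r => deriv (deriv w) r - 3 * deriv w r / (r : ℂ) + 3 * w r / (r : ℂ) ^ 2

/-- The eigenfunction `ṽ_2^κ = i D_2(exp(e^{-i3π/4} κ r) - exp(e^{i3π/4} κ r))`. -/
noncomputable def vTilde2 (κ : ℝ) : ℝ → ℂ :=
  fun r => Complex.I * D2 (fun s =>
    Complex.exp (Complex.exp (-Complex.I * (3 * Real.pi / 4)) * κ * s)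
      - Complex.exp (Complex.exp (Complex.I * (3 * Real.pi / 4)) * κ * s)) r

open Complex in
/-- A Taylor expansion of `r² D₂(e^{cr})` with analytic remainder. -/
lemma exists_analyticAt_exp_mul_quadratic (c : ℂ) : ∃ K : ℝ → ℂ, AnalyticAt ℝ K 0 ∧ ∀ r : ℝ,
    exp (c * r) * ((c * r) ^ 2 - 3 * (c * r) + 3) =
      3 - c ^ 2 * r ^ 2 / 2 + c ^ 4 * r ^ 4 / 8 + c ^ 5 * r ^ 5 / 15 + r ^ 6 * K r := by
  obtain ⟨F, hF, hexp⟩ :=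
    (analyticAt_cexp (z := 0)).exists_eq_sum_add_pow_mul 6
  have hc : AnalyticAt ℝ (fun r : ℝ ↦ c * (r : ℂ)) 0 :=
    analyticAt_const.mul (ofRealCLM.analyticAt 0)
  have hF' : AnalyticAt ℝ (fun r : ℝ ↦ F (c * r)) 0 :=
    AnalyticAt.fun_comp (by simpa using hF.restrictScalars) hc
  refine ⟨fun r ↦ c ^ 6 * (F (c * r) * ((c * r) ^ 2 - 3 * (c * r) + 3) + (1 / 60 + c * r / 120)),
    analyticAt_const.mul ((hF'.mul (((hc.pow 2).sub (analyticAt_const.mul hc)).add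
      analyticAt_const)).add (analyticAt_const.add (hc.div_const))), fun r ↦ ?_⟩
  rw [hexp]
  simp [Finset.sum_range_succ, iteratedDeriv_eq_iterate, iter_deriv_exp, Nat.factorial]
  ring

lemma deriv_eventuallyEq_nhdsGT {f g : ℝ → ℂ} {x : ℝ} (h : f =ᶠ[𝓝[>] x] g) :
    deriv f =ᶠ[𝓝[>] x] deriv g := by
  have h' := eventually_eventually_nhdsWithin.mpr h
  filter_upwards [h', self_mem_nhdsWithin] with y hy hxy
  rw [isOpen_Ioi.nhdsWithin_eq hxy] at hy
  exact Filter.EventuallyEq.deriv_eq hy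

lemma iterate_deriv_eventuallyEq_nhdsGT {f g : ℝ → ℂ} {x : ℝ} (h : f =ᶠ[𝓝[>] x] g) (n : ℕ) :
    deriv^[n] f =ᶠ[𝓝[>] x] deriv^[n] g := by
  induction n with
  | zero => exact h
  | succ n ih =>
    simp only [Function.iterate_succ_apply']
    exact deriv_eventuallyEq_nhdsGT ih

/-- One-sided limits of the first three derivatives read off from a one-sided Taylor expansion
with analytic remainder. -/
lemma tendsto_iterate_deriv_of_eventuallyEq_cubic {f K : ℝ → ℂ} {p q : ℂ} (hK : AnalyticAt ℝ K 0)
    (h : f =ᶠ[𝓝[>] 0] fun r ↦ p + q * r ^ 3 + r ^ 4 * K r) {n : ℕ} (hn : n < 4) :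
    Tendsto (deriv^[n] f) (𝓝[>] 0) (𝓝 (iteratedDeriv n (fun r : ℝ ↦ p + r ^ 3 • q) 0)) := by
  have hP : AnalyticAt ℝ (fun r : ℝ ↦ p + r ^ 3 • q) 0 := by fun_prop
  have hR : AnalyticAt ℝ (fun r : ℝ ↦ r ^ 4 • K r) 0 := by fun_prop
  have hR0 : iteratedDeriv n (fun r : ℝ ↦ r ^ 4 • K r) 0 = 0 :=
    (natCast_le_analyticOrderAt_iff_iteratedDeriv_eq_zero hR).mp
      ((natCast_le_analyticOrderAt hR).mpr ⟨K, hK, by simp⟩) n hn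
  have hf : f =ᶠ[𝓝[>] 0] fun r ↦ (p + r ^ 3 • q) + r ^ 4 • K r := by
    filter_upwards [h] with r hr
    rw [hr]
    simp [mul_comm q]
  have hlim : iteratedDeriv n (fun r : ℝ ↦ (p + r ^ 3 • q) + r ^ 4 • K r) 0
      = iteratedDeriv n (fun r : ℝ ↦ p + r ^ 3 • q) 0 := by
    rw [iteratedDeriv_fun_add hP.contDiffAt hR.contDiffAt, hR0, add_zero]
  rw [← hlim, iteratedDeriv_eq_iterate]
  exact (((hP.fun_add hR).iterated_deriv n).continuousAt.tendsto.mono_left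
    nhdsWithin_le_nhds).congr' (iterate_deriv_eventuallyEq_nhdsGT hf n).symm

lemma iteratedDeriv_const_add_pow_three_smul (p q : ℂ) :
    iteratedDeriv 0 (fun r : ℝ ↦ p + r ^ 3 • q) 0 = p ∧
    iteratedDeriv 1 (fun r : ℝ ↦ p + r ^ 3 • q) 0 = 0 ∧
    iteratedDeriv 2 (fun r : ℝ ↦ p + r ^ 3 • q) 0 = 0 ∧
    iteratedDeriv 3 (fun r : ℝ ↦ p + r ^ 3 • q) 0 = 6 * q := by
  have h (n : ℕ) (hn : 0 < n) : iteratedDeriv n (fun r : ℝ ↦ p + r ^ 3 • q) 0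
      = iteratedDeriv n (fun r : ℝ ↦ r ^ 3) 0 • q := by
    rw [iteratedDeriv_const_add hn, iteratedDeriv_smul_const (by fun_prop)]
  refine ⟨by simp, ?_, ?_, ?_⟩ <;>
    rw [h _ (by norm_num), iteratedDeriv_fun_pow_zero] <;>
    norm_num [Nat.factorial]

open Complex in
lemma hasDerivAt_exp_const_mul_ofReal (c : ℂ) (r : ℝ) :
    HasDerivAt (fun s : ℝ ↦ exp (c * s)) (c * exp (c * r)) r := by
  simpa [mul_comm] using ((hasDerivAt_id r).ofReal_comp.const_mul c).cexp

open Complex in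
lemma D2_exp_sub_exp (a b : ℂ) {r : ℝ} (hr : r ≠ 0) :
    D2 (fun s ↦ exp (a * s) - exp (b * s)) r =
      (exp (a * r) * ((a * r) ^ 2 - 3 * (a * r) + 3)
        - exp (b * r) * ((b * r) ^ 2 - 3 * (b * r) + 3)) / r ^ 2 := by
  have h1 : deriv (fun s : ℝ ↦ exp (a * s) - exp (b * s)) =
      fun s : ℝ ↦ a * exp (a * s) - b * exp (b * s) := funext fun s ↦
    ((hasDerivAt_exp_const_mul_ofReal a s).sub (hasDerivAt_exp_const_mul_ofReal b s)).deriv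
  have h2 : deriv (fun s : ℝ ↦ a * exp (a * s) - b * exp (b * s)) r =
      a * (a * exp (a * r)) - b * (b * exp (b * r)) :=
    (((hasDerivAt_exp_const_mul_ofReal a r).const_mul a).sub
      ((hasDerivAt_exp_const_mul_ofReal b r).const_mul b)).deriv
  have hr' : (r : ℂ) ≠ 0 := ofReal_ne_zero.mpr hr
  rw [D2, h1, h2]
  field_simp
  ring

open Complex in
lemma exp_I_three_pi_div_four :
    exp (I * (3 * Real.pi / 4)) = (√2 / 2 : ℝ) * (-1 + I) := by
  have h : I * (3 * Real.pi / 4) = ((Real.pi - Real.pi / 4 : ℝ) : ℂ) * I := by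
    push_cast
    ring
  rw [h, exp_mul_I, ← ofReal_cos, ← ofReal_sin, Real.cos_pi_sub, Real.sin_pi_sub,
    Real.cos_pi_div_four, Real.sin_pi_div_four]
  push_cast
  ring

open Complex in
lemma exp_neg_I_three_pi_div_four :
    exp (-I * (3 * Real.pi / 4)) = (√2 / 2 : ℝ) * (-1 - I) := by
  have h : -I * (3 * Real.pi / 4) = (starRingEnd ℂ) (I * (3 * Real.pi / 4)) := by
    simp [Complex.conj_ofNat]
  rw [h, exp_conj, exp_I_three_pi_div_four]
  simp [Complex.conj_ofNat]
  ring

open Complex in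
lemma exists_vTilde2_eq (κ : ℝ) : ∃ K : ℝ → ℂ, AnalyticAt ℝ K 0 ∧ ∀ r : ℝ, r ≠ 0 →
    vTilde2 κ r = κ ^ 2 + -(√2 * κ ^ 5 / 15 : ℂ) * r ^ 3 + r ^ 4 * K r := by
  obtain ⟨A, hA, hA'⟩ :=
    exists_analyticAt_exp_mul_quadratic (exp (-I * (3 * Real.pi / 4)) * κ)
  obtain ⟨B, hB, hB'⟩ :=
    exists_analyticAt_exp_mul_quadratic (exp (I * (3 * Real.pi / 4)) * κ)
  refine ⟨fun r ↦ I * (A r - B r), by fun_prop, fun r hr ↦ ?_⟩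
  rw [vTilde2, D2_exp_sub_exp _ _ hr, hA', hB', exp_I_three_pi_div_four,
    exp_neg_I_three_pi_div_four]
  have hr' : (r : ℂ) ≠ 0 := ofReal_ne_zero.mpr hr
  have hs : (√2 : ℂ) ^ 2 = 2 := by
    rw [← ofReal_pow, Real.sq_sqrt zero_le_two, ofReal_ofNat]
  have h4 : (√2 : ℂ) ^ 4 = 4 := by linear_combination ((√2 : ℂ) ^ 2 + 2) * hs
  have h5 : (√2 : ℂ) ^ 5 = 4 * √2 := by linear_combination (√2 : ℂ) * h4
  have I6 : I ^ 6 = -1 := by linear_combination I ^ 2 * I_pow_four + I_sq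
  push_cast
  field_simp
  ring_nf
  simp only [hs, h4, h5, I_sq, I_pow_four, I6]
  ring

/-- Boundary behaviour of `ṽ_2^κ` as `r → 0⁺`: `ṽ_2^κ → κ²`, `(ṽ_2^κ)' → 0`,
`(ṽ_2^κ)'' → 0`, `(ṽ_2^κ)''' → -(2√2/5) κ⁵`; so `ṽ_2^κ` satisfies the boundary
conditions `u'''(0) = -(2√2/5) κ³ u(0)`, `u'(0) = u''(0) = 0` defining the
domain of the self-adjoint extension `T_{2κ}²`. -/
theorem stmt15 (κ : ℝ) (hκ : 0 < κ) :
    Tendsto (vTilde2 κ) (nhdsWithin 0 (Ioi 0)) (nhds ((κ : ℂ) ^ 2)) ∧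
    Tendsto (deriv (vTilde2 κ)) (nhdsWithin 0 (Ioi 0)) (nhds 0) ∧
    Tendsto (deriv (deriv (vTilde2 κ))) (nhdsWithin 0 (Ioi 0)) (nhds 0) ∧
    Tendsto (deriv (deriv (deriv (vTilde2 κ)))) (nhdsWithin 0 (Ioi 0))
      (nhds ((-(2 * Real.sqrt 2 / 5) * κ ^ 5 : ℝ) : ℂ)) := by
  obtain ⟨K, hK, hv⟩ := exists_vTilde2_eq κ
  have h : vTilde2 κ =ᶠ[𝓝[>] 0] fun r ↦ κ ^ 2 + -(√2 * κ ^ 5 / 15 : ℂ) * r ^ 3 + r ^ 4 * K r := by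
    filter_upwards [self_mem_nhdsWithin] with r hr using hv r (ne_of_gt hr)
  obtain ⟨d0, d1, d2, d3⟩ :=
    iteratedDeriv_const_add_pow_three_smul ((κ : ℂ) ^ 2) (-(√2 * κ ^ 5 / 15 : ℂ))
  refine ⟨?_, ?_, ?_, ?_⟩
  · exact d0 ▸ tendsto_iterate_deriv_of_eventuallyEq_cubic hK h (n := 0) (by norm_num)
  · exact d1 ▸ tendsto_iterate_deriv_of_eventuallyEq_cubic hK h (n := 1) (by norm_num)
  · exact d2 ▸ tendsto_iterate_deriv_of_eventuallyEq_cubic hK h (n := 2) (by norm_num)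
  · have hq : ((-(2 * √2 / 5) * κ ^ 5 : ℝ) : ℂ) = 6 * -(√2 * κ ^ 5 / 15) := by
      push_cast
      ring
    rw [hq]
    exact d3 ▸ tendsto_iterate_deriv_of_eventuallyEq_cubic hK h (n := 3) (by norm_num)
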